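/- Let σ be a finite sequence of natural numbers in sawtooth form. If P is an unpierced hexagon of type 1 of G(σ) that is not empty, then G(σ) contains an unpierced box, an unpierced hexagon of type 1, or an unpierced hexagon of type 2 that is strictly inside P. -/

import Mathlib

/-- A finite sequence of natural numbers is in sawtooth form if whenever an entry
is less than the next one, the next one is exactly one more. -/
def Sawtooth (σ : List ℕ) : Prop :=
  ∀ i : ℕ, i + 1 < σ.length →
    σ.getD i 0 < σ.getD (i + 1) 0 → σ.getD (i + 1) 0 = σ.getD i 0 + 1

/-- A commutation swaps two adjacent entries whose values differ by more than 1. -/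
def Commutation (σ τ : List ℕ) : Prop :=
  ∃ (l r : List ℕ) (x y : ℕ),
    (x + 1 < y ∨ y + 1 < x) ∧ σ = l ++ x :: y :: r ∧ τ = l ++ y :: x :: r

/-- `(i, j)` is a dot of the dot graph `G(σ)` (the first coordinate is 1-based). -/
def IsDot (σ : List ℕ) (i j : ℤ) : Prop :=
  ∃ k : Fin σ.length, i = ((k : ℕ) : ℤ) + 1 ∧ j = ((σ.get k : ℕ) : ℤ)

/-- The dots `(a, y), (a+1, y+1), …, (a+t, y+t)` all belong to `G(σ)`; equivalently
(for `0 ≤ t`) the dots `(a, y)` and `(a+t, y+t)` lie on a common ascending segment. -/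
def OnAsc (σ : List ℕ) (a y t : ℤ) : Prop :=
  ∀ s : ℤ, 0 ≤ s → s ≤ t → IsDot σ (a + s) (y + s)

/-- The dots `(a, y), …, (a+m, y+m)` form an entire (i.e. maximal) ascending segment. -/
def IsAscSeg (σ : List ℕ) (a y : ℤ) (m : ℕ) : Prop :=
  OnAsc σ a y (m : ℤ) ∧ ¬ IsDot σ (a - 1) (y - 1) ∧
    ¬ IsDot σ (a + (m : ℤ) + 1) (y + (m : ℤ) + 1)

/-- A box of `G(σ)` with lower horizontal edge from `(a, y)` to `(b, y)` and
ascending edges of length `t`. -/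
def IsBox (σ : List ℕ) (a b y t : ℤ) : Prop :=
  0 ≤ t ∧ a + t < b ∧
  OnAsc σ a y t ∧ ¬ IsDot σ (a + t + 1) (y + t + 1) ∧
  OnAsc σ b y t ∧ ¬ IsDot σ (b - 1) (y - 1)

/-- No dot of `G(σ)` lies in the open interior of either horizontal edge of the box. -/
def BoxUnpierced (σ : List ℕ) (a b y t : ℤ) : Prop :=
  (∀ i : ℤ, a < i → i < b → ¬ IsDot σ i y) ∧
  (∀ i : ℤ, a + t < i → i < b + t → ¬ IsDot σ i (y + t))

/-- No dot of `G(σ)` lies in the open interior of the box. -/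
def BoxEmpty (σ : List ℕ) (a b y t : ℤ) : Prop :=
  ∀ i h : ℤ, y < h → h < y + t → a + (h - y) < i → i < b + (h - y) → ¬ IsDot σ i h

/-- The closed region of the box. -/
def BoxRegion (a b y t : ℤ) : Set (ℤ × ℤ) :=
  {p | y ≤ p.2 ∧ p.2 ≤ y + t ∧ a + (p.2 - y) ≤ p.1 ∧ p.1 ≤ b + (p.2 - y)}

/-- A hexagon of type 1 of `G(σ)`. -/
def IsHex1 (σ : List ℕ) (a b c y L M : ℤ) : Prop :=
  0 ≤ M ∧ M ≤ L ∧ a < b ∧ b + M < c ∧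
  OnAsc σ a y L ∧ ¬ IsDot σ (a + L + 1) (y + L + 1) ∧
  OnAsc σ b y M ∧ ¬ IsDot σ (b - 1) (y - 1) ∧ ¬ IsDot σ (b + M + 1) (y + M + 1) ∧
  OnAsc σ c (y + M) (L - M)

/-- No dot of `G(σ)` lies in the open interior of any of the three horizontal
edges of the type 1 hexagon. -/
def Hex1Unpierced (σ : List ℕ) (a b c y L M : ℤ) : Prop :=
  (∀ i : ℤ, a < i → i < b → ¬ IsDot σ i y) ∧
  (∀ i : ℤ, b + M < i → i < c → ¬ IsDot σ i (y + M)) ∧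
  (∀ i : ℤ, a + L < i → i < c + L - M → ¬ IsDot σ i (y + L))

/-- The open interior of the type 1 hexagon. -/
def Hex1Interior (a b c y L M : ℤ) : Set (ℤ × ℤ) :=
  {p | y < p.2 ∧ p.2 < y + L ∧ a + (p.2 - y) < p.1 ∧
    (p.2 ≤ y + M → p.1 < b + (p.2 - y)) ∧ (y + M ≤ p.2 → p.1 < c + (p.2 - y - M))}

/-- No dot of `G(σ)` lies in the open interior of the type 1 hexagon. -/
def Hex1Empty (σ : List ℕ) (a b c y L M : ℤ) : Prop :=
  ∀ p ∈ Hex1Interior a b c y L M, ¬ IsDot σ p.1 p.2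

/-- The closed region of the type 1 hexagon (open interior together with its
horizontal and ascending edges). -/
def Hex1Region (a b c y L M : ℤ) : Set (ℤ × ℤ) :=
  {p | y ≤ p.2 ∧ p.2 ≤ y + L ∧ a + (p.2 - y) ≤ p.1 ∧
    (p.2 < y + M → p.1 ≤ b + (p.2 - y)) ∧ (y + M ≤ p.2 → p.1 ≤ c + (p.2 - y - M))}

/-- A hexagon of type 2 of `G(σ)`. -/
def IsHex2 (σ : List ℕ) (p q r y L M : ℤ) : Prop :=
  0 ≤ M ∧ M ≤ L ∧ p < q ∧ p + (L - M) < r ∧ r + M < q + L ∧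
  OnAsc σ p y (L - M) ∧
  OnAsc σ r (y + L - M) M ∧ ¬ IsDot σ (r - 1) (y + L - M - 1) ∧
    ¬ IsDot σ (r + M + 1) (y + L + 1) ∧
  OnAsc σ q y L ∧ ¬ IsDot σ (q - 1) (y - 1)

/-- No dot of `G(σ)` lies in the open interior of any of the three horizontal
edges of the type 2 hexagon. -/
def Hex2Unpierced (σ : List ℕ) (p q r y L M : ℤ) : Prop :=
  (∀ i : ℤ, p < i → i < q → ¬ IsDot σ i y) ∧
  (∀ i : ℤ, p + (L - M) < i → i < r → ¬ IsDot σ i (y + L - M)) ∧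
  (∀ i : ℤ, r + M < i → i < q + L → ¬ IsDot σ i (y + L))

/-- The open interior of the type 2 hexagon. -/
def Hex2Interior (p q r y L M : ℤ) : Set (ℤ × ℤ) :=
  {x | y < x.2 ∧ x.2 < y + L ∧ x.1 < q + (x.2 - y) ∧
    (x.2 ≤ y + L - M → p + (x.2 - y) < x.1) ∧
    (y + L - M ≤ x.2 → r + (x.2 - y - L + M) < x.1)}

/-- No dot of `G(σ)` lies in the open interior of the type 2 hexagon. -/
def Hex2Empty (σ : List ℕ) (p q r y L M : ℤ) : Prop :=
  ∀ x ∈ Hex2Interior p q r y L M, ¬ IsDot σ x.1 x.2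

/-- The closed region of the type 2 hexagon (open interior together with its
horizontal and ascending edges). -/
def Hex2Region (p q r y L M : ℤ) : Set (ℤ × ℤ) :=
  {x | y ≤ x.2 ∧ x.2 ≤ y + L ∧ x.1 ≤ q + (x.2 - y) ∧
    (x.2 ≤ y + L - M → p + (x.2 - y) ≤ x.1) ∧
    (y + L - M < x.2 → r + (x.2 - y - L + M) ≤ x.1)}

/-- The number of dots of `G(σ)` lying in a region `R`. -/
noncomputable def DotsIn (σ : List ℕ) (R : Set (ℤ × ℤ)) : ℕ :=
  {p : ℤ × ℤ | IsDot σ p.1 p.2 ∧ p ∈ R}.ncard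

/-- A region `RQ` is strictly inside a region `RP` (with respect to `G(σ)`) if
`RQ ⊆ RP` and `RQ` contains strictly fewer dots of `G(σ)` than `RP`. -/
def StrictlyInside (σ : List ℕ) (RQ RP : Set (ℤ × ℤ)) : Prop :=
  RQ ⊆ RP ∧ DotsIn σ RQ < DotsIn σ RP

/-- A dot graph polygon: a box, a hexagon of type 1, or a hexagon of type 2. -/
inductive DGPoly : Type where
  | box (a b y t : ℤ)
  | hex1 (a b c y L M : ℤ)
  | hex2 (p q r y L M : ℤ)

/-- The polygon is genuinely a box/hexagon of type 1/hexagon of type 2 of `G(σ)`. -/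
def DGPoly.Valid (σ : List ℕ) : DGPoly → Prop
  | .box a b y t => IsBox σ a b y t
  | .hex1 a b c y L M => IsHex1 σ a b c y L M
  | .hex2 p q r y L M => IsHex2 σ p q r y L M

/-- The polygon is unpierced. -/
def DGPoly.Unpierced (σ : List ℕ) : DGPoly → Prop
  | .box a b y t => BoxUnpierced σ a b y t
  | .hex1 a b c y L M => Hex1Unpierced σ a b c y L M
  | .hex2 p q r y L M => Hex2Unpierced σ p q r y L M

/-- The polygon is empty. -/
def DGPoly.IsEmpty (σ : List ℕ) : DGPoly → Prop
  | .box a b y t => BoxEmpty σ a b y t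
  | .hex1 a b c y L M => Hex1Empty σ a b c y L M
  | .hex2 p q r y L M => Hex2Empty σ p q r y L M

/-- The closed region of the polygon. -/
def DGPoly.Region : DGPoly → Set (ℤ × ℤ)
  | .box a b y t => BoxRegion a b y t
  | .hex1 a b c y L M => Hex1Region a b c y L M
  | .hex2 p q r y L M => Hex2Region p q r y L M

theorem IsDot.height_eq {σ : List ℕ} {i j j' : ℤ} (h : IsDot σ i j) (h' : IsDot σ i j') :
    j = j' := by
  obtain ⟨k, hk, hj⟩ := h
  obtain ⟨k', hk', hj'⟩ := h'
  have : k = k' := Fin.ext (by omega)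
  subst this
  omega

theorem IsDot.pos {σ : List ℕ} {i j : ℤ} (h : IsDot σ i j) : 0 < i := by
  obtain ⟨k, hk, _⟩ := h
  omega

theorem IsDot.le_length {σ : List ℕ} {i j : ℤ} (h : IsDot σ i j) : i ≤ σ.length := by
  obtain ⟨k, hk, _⟩ := h
  have := k.isLt
  omega

theorem finite_setOf_isDot (σ : List ℕ) : {p : ℤ × ℤ | IsDot σ p.1 p.2}.Finite := by
  refine (Set.finite_range fun k : Fin σ.length =>
    (((k : ℕ) : ℤ) + 1, ((σ.get k : ℕ) : ℤ))).subset ?_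
  rintro ⟨i, j⟩ ⟨k, hi, hj⟩
  exact ⟨k, Prod.ext hi.symm hj.symm⟩

theorem strictlyInside_of_dot {σ : List ℕ} {R R' : Set (ℤ × ℤ)} (hsub : R ⊆ R') {i j : ℤ}
    (hdot : IsDot σ i j) (hmem : (i, j) ∈ R') (hnot : (i, j) ∉ R) : StrictlyInside σ R R' := by
  refine ⟨hsub, Set.ncard_lt_ncard ?_ ((finite_setOf_isDot σ).subset fun p hp => hp.1)⟩
  have hle : {p : ℤ × ℤ | IsDot σ p.1 p.2 ∧ p ∈ R} ⊆ {p : ℤ × ℤ | IsDot σ p.1 p.2 ∧ p ∈ R'} :=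
    fun p hp => ⟨hp.1, hsub hp.2⟩
  exact (Set.ssubset_iff_of_subset hle).2 ⟨(i, j), ⟨hdot, hmem⟩, fun hp => hnot hp.2⟩

theorem OnAsc.isDot {σ : List ℕ} {a y t i h : ℤ} (H : OnAsc σ a y t) (h₁ : y ≤ h)
    (h₂ : h ≤ y + t) (hi : i = a + (h - y)) : IsDot σ i h := by
  have := H (h - y) (by omega) (by omega)
  rwa [← hi, add_sub_cancel] at this

theorem OnAsc.sub {σ : List ℕ} {a y t a' y' t' : ℤ} (H : OnAsc σ a y t) (h₁ : y ≤ y')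
    (h₂ : y' + t' ≤ y + t) (ha : a' = a + (y' - y)) : OnAsc σ a' y' t' :=
  fun s hs hst => H.isDot (by omega) (by omega) (by omega)

/-- Two ascending segments that start in the same row occupy disjoint sets of columns. -/
theorem OnAsc.add_lt {σ : List ℕ} {a b y t : ℤ} (H : OnAsc σ a y t) (hb : IsDot σ b y)
    (hab : a < b) : a + t < b := by
  by_contra hlt
  have := (H (b - a) (by omega) (by omega))
  rw [add_sub_cancel] at this
  have := this.height_eq hb
  omega

theorem IsDot.exists_top {σ : List ℕ} {i h : ℤ} (hd : IsDot σ i h) :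
    ∃ k : ℤ, 0 ≤ k ∧ OnAsc σ i h k ∧ ¬ IsDot σ (i + k + 1) (h + k + 1) := by
  classical
  have hex : ∃ n : ℕ, ¬ IsDot σ (i + n + 1) (h + n + 1) := by
    refine ⟨σ.length, fun hn => ?_⟩
    have := hn.le_length
    have := hd.pos
    omega
  refine ⟨Nat.find hex, by omega, fun s hs hsk => ?_, Nat.find_spec hex⟩
  rcases hs.eq_or_lt with rfl | hs
  · simpa using hd
  · have := Nat.find_min hex (m := (s - 1).toNat) (by omega)
    rw [not_not] at this
    convert this using 1 <;> omega

theorem IsDot.exists_bottom {σ : List ℕ} {i h : ℤ} (hd : IsDot σ i h) :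
    ∃ k : ℤ, 0 ≤ k ∧ OnAsc σ (i - k) (h - k) k ∧ ¬ IsDot σ (i - k - 1) (h - k - 1) := by
  classical
  have hex : ∃ n : ℕ, ¬ IsDot σ (i - n - 1) (h - n - 1) := by
    refine ⟨i.toNat, fun hn => ?_⟩
    have := hn.pos
    omega
  refine ⟨Nat.find hex, by omega, fun s hs hsk => ?_, Nat.find_spec hex⟩
  rcases hsk.eq_or_lt with rfl | hsk
  · simpa using hd
  · have := Nat.find_min hex (m := (Nat.find hex - s - 1).toNat) (by omega)
    rw [not_not] at this
    convert this using 1 <;> omega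

theorem exists_first_dot {σ : List ℕ} {lo hi h : ℤ}
    (H : ¬ ∀ i : ℤ, lo < i → i < hi → ¬ IsDot σ i h) :
    ∃ i : ℤ, lo < i ∧ i < hi ∧ IsDot σ i h ∧ ∀ j : ℤ, lo < j → j < i → ¬ IsDot σ j h := by
  push Not at H
  obtain ⟨i, ⟨h₁, h₂, h₃⟩, hmin⟩ := Int.exists_least_of_bdd
    (P := fun i => lo < i ∧ i < hi ∧ IsDot σ i h) ⟨lo, fun z hz => hz.1.le⟩ H
  refine ⟨i, h₁, h₂, h₃, fun j hj hji hd => ?_⟩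
  have := hmin j ⟨hj, by omega, hd⟩
  omega

theorem exists_last_dot {σ : List ℕ} {lo hi h : ℤ}
    (H : ¬ ∀ i : ℤ, lo < i → i < hi → ¬ IsDot σ i h) :
    ∃ i : ℤ, lo < i ∧ i < hi ∧ IsDot σ i h ∧ ∀ j : ℤ, i < j → j < hi → ¬ IsDot σ j h := by
  push Not at H
  obtain ⟨i, ⟨h₁, h₂, h₃⟩, hmax⟩ := Int.exists_greatest_of_bdd
    (P := fun i => lo < i ∧ i < hi ∧ IsDot σ i h) ⟨hi, fun z hz => hz.2.1.le⟩ H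
  refine ⟨i, h₁, h₂, h₃, fun j hij hj hd => ?_⟩
  have := hmax j ⟨by omega, hj, hd⟩
  omega

/-- A box with an unpierced horizontal edge contains an unpierced box. -/
theorem IsBox.exists_unpierced {σ : List ℕ} {a b y t : ℤ} (hbox : IsBox σ a b y t)
    (hedge : (∀ i : ℤ, a < i → i < b → ¬ IsDot σ i y) ∨
      (∀ i : ℤ, a + t < i → i < b + t → ¬ IsDot σ i (y + t))) :
    ∃ a' b' y' t' : ℤ, IsBox σ a' b' y' t' ∧ BoxUnpierced σ a' b' y' t' ∧
      BoxRegion a' b' y' t' ⊆ BoxRegion a b y t := by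
  induction hn : (b - a).toNat using Nat.strong_induction_on generalizing a b y t with
  | _ n ih =>
  obtain ⟨ht, hab, hA, hAtop, hB, hBbot⟩ := hbox
  by_cases hlow : ∀ i : ℤ, a < i → i < b → ¬ IsDot σ i y
  · by_cases hup : ∀ i : ℤ, a + t < i → i < b + t → ¬ IsDot σ i (y + t)
    · exact ⟨a, b, y, t, ⟨ht, hab, hA, hAtop, hB, hBbot⟩, ⟨hlow, hup⟩, subset_rfl⟩
    obtain ⟨i, hi₁, hi₂, hid, hifirst⟩ := exists_first_dot hup
    obtain ⟨k, hk, hseg, hbot⟩ := hid.exists_bottom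
    have hkt : k < t := by
      by_contra hkt
      exact hlow (i - t) (by omega) (by omega) (hseg.isDot (by omega) (by omega) (by omega))
    have hsub : OnAsc σ (a + (t - k)) (y + t - k) k := hA.sub (by omega) (by omega) (by omega)
    have hlt := hsub.add_lt (hseg.isDot (i := i - k) le_rfl (by omega) (by omega)) (by omega)
    obtain ⟨a', b', y', t', h₁, h₂, h₃⟩ := ih _ (by omega)
      (a := a + (t - k)) (b := i - k) (y := y + t - k) (t := k)
      ⟨hk, hlt, hsub, by convert hAtop using 2 <;> omega, hseg, hbot⟩
      (Or.inr fun j hj hj' => by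
        rw [sub_add_cancel]
        exact hifirst j (by omega) (by omega)) rfl
    refine ⟨a', b', y', t', h₁, h₂, h₃.trans ?_⟩
    rintro ⟨u, v⟩ hp
    simp only [BoxRegion, Set.mem_ofPred_eq] at hp ⊢
    omega
  · have hup := hedge.resolve_left hlow
    obtain ⟨i, hi₁, hi₂, hid, hilast⟩ := exists_last_dot hlow
    obtain ⟨k, hk, hseg, htop⟩ := hid.exists_top
    have hkt : k < t := by
      by_contra hkt
      exact hup (i + t) (by omega) (by omega) (hseg.isDot (by omega) (by omega) (by omega))
    have hsub : OnAsc σ b y k := hB.sub (by omega) (by omega) (by omega)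
    have hlt := hseg.add_lt (hsub.isDot (i := b) le_rfl (by omega) (by omega)) (by omega)
    obtain ⟨a', b', y', t', h₁, h₂, h₃⟩ := ih _ (by omega)
      (a := i) (b := b) (y := y) (t := k) ⟨hk, hlt, hseg, htop, hsub, hBbot⟩ (Or.inl hilast) rfl
    refine ⟨a', b', y', t', h₁, h₂, h₃.trans ?_⟩
    rintro ⟨u, v⟩ hp
    simp only [BoxRegion, Set.mem_ofPred_eq] at hp ⊢
    omega

/-- An ascending segment cannot leave the interior of an unpierced type 1 hexagon upwards. -/
theorem Hex1Unpierced.interior_up {σ : List ℕ} {a b c y L M i h k : ℤ}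
    (hhex : IsHex1 σ a b c y L M) (hunp : Hex1Unpierced σ a b c y L M)
    (hint : (i, h) ∈ Hex1Interior a b c y L M) (hk : 0 ≤ k) (hseg : OnAsc σ i h k) :
    (i + k, h + k) ∈ Hex1Interior a b c y L M := by
  obtain ⟨_, _, _, hbc, -⟩ := hhex
  simp only [Hex1Interior, Set.mem_ofPred_eq] at hint ⊢
  have : h + k < y + L := by
    by_contra hlt
    exact hunp.2.2 (i + (y + L - h)) (by omega) (by omega)
      (hseg.isDot (by omega) (by omega) (by omega))
  omega

/-- An ascending segment cannot leave the interior of an unpierced type 1 hexagon downwards. -/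
theorem Hex1Unpierced.interior_down {σ : List ℕ} {a b c y L M i h k : ℤ}
    (hhex : IsHex1 σ a b c y L M) (hunp : Hex1Unpierced σ a b c y L M)
    (hint : (i + k, h + k) ∈ Hex1Interior a b c y L M) (hk : 0 ≤ k) (hseg : OnAsc σ i h k) :
    (i, h) ∈ Hex1Interior a b c y L M := by
  obtain ⟨_, _, _, hbc, _, _, _, _, hbtop, _⟩ := hhex
  simp only [Hex1Interior, Set.mem_ofPred_eq] at hint ⊢
  have hside : h ≤ y + M → i < b + (h - y) := by
    intro hh
    by_contra hlt
    have hM : y + M < h + k := by omega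
    by_cases heq : i = b + (h - y)
    · exact hbtop (hseg.isDot (by omega) (by omega) (by omega))
    · exact hunp.2.1 (i + (y + M - h)) (by omega) (by omega)
        (hseg.isDot (by omega) (by omega) (by omega))
  have : y < h := by
    by_contra hlt
    exact hunp.1 (i + (y - h)) (by omega) (by omega)
      (hseg.isDot (by omega) (by omega) (by omega))
  omega

/-- If `P` is an unpierced hexagon of type 1 of `G(σ)` that is not
empty, then `G(σ)` contains an unpierced box, an unpierced hexagon of type 1, or an
unpierced hexagon of type 2 that is strictly inside `P`. -/
theorem unpierced_hex1_not_empty (σ : List ℕ) (hsaw : Sawtooth σ)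
    (a b c y L M : ℤ) (hhex : IsHex1 σ a b c y L M)
    (hunp : Hex1Unpierced σ a b c y L M) (hne : ¬ Hex1Empty σ a b c y L M) :
    ∃ Q : DGPoly, Q.Valid σ ∧ Q.Unpierced σ ∧
      StrictlyInside σ Q.Region (Hex1Region a b c y L M) := by
  have hmem : ∃ h i : ℤ, (i, h) ∈ Hex1Interior a b c y L M ∧ IsDot σ i h := by
    simp only [Hex1Empty, not_forall, not_not] at hne
    obtain ⟨p, hp, hd⟩ := hne
    exact ⟨p.2, p.1, hp, hd⟩
  obtain ⟨B, ⟨x₀, hx₀⟩, hBmin⟩ := Int.exists_least_of_bdd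
    (P := fun h => ∃ i : ℤ, (i, h) ∈ Hex1Interior a b c y L M ∧ IsDot σ i h)
    ⟨y, fun z ⟨_, hz, _⟩ => hz.1.le⟩ hmem
  obtain ⟨x, ⟨hxint, hxd⟩, hxmin⟩ := Int.exists_least_of_bdd
    (P := fun i => (i, B) ∈ Hex1Interior a b c y L M ∧ IsDot σ i B)
    ⟨0, fun z hz => hz.2.pos.le⟩ ⟨x₀, hx₀⟩
  obtain ⟨k, hk, hS, hStop⟩ := hxd.exists_top
  have htopint := hunp.interior_up hhex hxint hk hS
  have hSbot : ¬ IsDot σ (x - 1) (B - 1) := by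
    intro hd
    have hseg : OnAsc σ (x - 1) (B - 1) 1 := fun s hs hs' => by
      obtain rfl | rfl : s = 0 ∨ s = 1 := by omega
      · simpa using hd
      · simpa using hxd
    have := hBmin (B - 1) ⟨x - 1,
      hunp.interior_down hhex (by simpa using hxint) zero_le_one hseg, hd⟩
    omega
  have hlow : ∀ i : ℤ, a + (B - y) < i → i < x → ¬ IsDot σ i B := by
    intro i h₁ h₂ hd
    have := hxmin i ⟨by simp only [Hex1Interior, Set.mem_ofPred_eq] at hxint ⊢; omega, hd⟩
    omega
  have hhex₁ := hhex
  obtain ⟨hM, hML, hab, hbc, hA, hAtop, hb, hbbot, hbtop, hc⟩ := hhex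
  have hay : IsDot σ a y := hA.isDot le_rfl (by omega) (by omega)
  have haL : IsDot σ (a + L) (y + L) := hA.isDot (by omega) (by omega) (by omega)
  obtain ⟨w, hw⟩ :
      ∃ w : ℤ, w = if B + k ≤ y + M then b + (B + k - y) else c + (B + k - y - M) := ⟨_, rfl⟩
  by_cases hup : ∀ i : ℤ, x + k < i → i < w → ¬ IsDot σ i (B + k)
  · simp only [Hex1Interior, Set.mem_ofPred_eq] at hxint htopint
    by_cases hkM : B + k ≤ y + M
    · rw [if_pos hkM] at hw
      refine ⟨.hex2 a b x y (B + k - y) k,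
        ⟨hk, by omega, hab, by omega, by omega, hA.sub le_rfl (by omega) (by omega),
          hS.sub (by omega) (by omega) (by omega), ?_, ?_,
          hb.sub le_rfl (by omega) (by omega), hbbot⟩,
        ⟨hunp.1, fun i h₁ h₂ => ?_, fun i h₁ h₂ => ?_⟩,
        strictlyInside_of_dot ?_ haL ?_ ?_⟩
      · convert hSbot using 2; omega
      · convert hStop using 2; omega
      · convert hlow i (by omega) h₂ using 2; omega
      · convert hup i h₁ (by omega) using 2; omega
      · rintro ⟨u, v⟩ hp
        simp only [DGPoly.Region, Hex2Region, Hex1Region, Set.mem_ofPred_eq] at hp ⊢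
        omega
      · simp only [Hex1Region, Set.mem_ofPred_eq]
        omega
      · simp only [DGPoly.Region, Hex2Region, Set.mem_ofPred_eq]
        omega
    · rw [if_neg hkM] at hw
      refine ⟨.hex1 (a + (B - y)) x w B (y + L - B) k,
        ⟨hk, by omega, by omega, by omega, hA.sub (by omega) (by omega) (by omega), ?_,
          hS, hSbot, hStop, hc.sub (by omega) (by omega) (by omega)⟩,
        ⟨hlow, hup, fun i h₁ h₂ => ?_⟩,
        strictlyInside_of_dot ?_ hay ?_ ?_⟩
      · convert hAtop using 2 <;> omega
      · convert hunp.2.2 i (by omega) (by omega) using 2; omega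
      · rintro ⟨u, v⟩ hp
        simp only [DGPoly.Region, Hex1Region, Set.mem_ofPred_eq] at hp ⊢
        omega
      · simp only [Hex1Region, Set.mem_ofPred_eq]
        omega
      · simp only [DGPoly.Region, Hex1Region, Set.mem_ofPred_eq]
        omega
  · obtain ⟨i, hi₁, hi₂, hid, hifirst⟩ := exists_first_dot hup
    obtain ⟨m, hm, hseg, hbot⟩ := hid.exists_bottom
    have hiint : (i, B + k) ∈ Hex1Interior a b c y L M := by
      simp only [Hex1Interior, Set.mem_ofPred_eq] at htopint ⊢
      split_ifs at hw <;> omega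
    have hjint : (i - m, B + k - m) ∈ Hex1Interior a b c y L M :=
      hunp.interior_down hhex₁ (by simpa using hiint) hm hseg
    have hjd : IsDot σ (i - m) (B + k - m) := hseg.isDot le_rfl (by omega) (by omega)
    have hBm := hBmin _ ⟨_, hjint, hjd⟩
    have hsub : OnAsc σ (x + (k - m)) (B + k - m) m := hS.sub (by omega) (by omega) (by omega)
    have hlt := hsub.add_lt hjd (by omega)
    have hbox : IsBox σ (x + (k - m)) (i - m) (B + k - m) m :=
      ⟨hm, hlt, hsub, by convert hStop using 2 <;> omega, hseg, hbot⟩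
    obtain ⟨a', b', y', t', h₁, h₂, h₃⟩ := hbox.exists_unpierced
      (Or.inr fun j hj hj' => by
        rw [sub_add_cancel]
        exact hifirst j (by omega) (by omega))
    simp only [Hex1Interior, Set.mem_ofPred_eq] at hxint hiint hjint
    refine ⟨.box a' b' y' t', h₁, h₂, strictlyInside_of_dot (h₃.trans ?_) hay ?_ ?_⟩
    · rintro ⟨u, v⟩ hp
      simp only [BoxRegion, Hex1Region, Set.mem_ofPred_eq] at hp ⊢
      omega
    · simp only [Hex1Region, Set.mem_ofPred_eq]
      omega
    · intro hp
      have := h₃ hp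
      simp only [BoxRegion, Set.mem_ofPred_eq] at this
      omega
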